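/- For every choice of the real parameters ζ₁₁, ζ₂₂, ζ₃₃, ζ₁₂, ζ₁₃, ζ₂₃, ξ₁₁, ξ₂₂, ξ₃₃, ξ₁₂, ξ₁₃, ξ₂₃ and for all i ≠ j in {1,...,4}, the cube-boundary integral ∑_{l=1}^4 ∫_{[−1,1]³} [ G_{ij,l}(x)|_{x^l=1} − G_{ij,l}(x)|_{x^l=−1} ] dx̂ˡ equals 0, where G_{ij,l}(x) = ∂_l( h_{ij}(x)·|x|²/4 ) + x^j·h_{il}(x) + x^i·h_{jl}(x), and for each l the integration is over the remaining three coordinates ranging over [−1,1]³. Consequently the constant C_{ij} in the expansion u_{ij} = xⁱxʲ − η̃_{ij} + C_{ij}/r² + O(r^{−3+ε}) vanishes for i ≠ j. -/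

import Mathlib

open scoped BigOperators

noncomputable section

/-- Partial derivative in the `i`-th coordinate direction. -/
def pd {n : ℕ} (i : Fin n) (f : (Fin n → ℝ) → ℝ) : (Fin n → ℝ) → ℝ :=
  fun x => fderiv ℝ f x (Pi.single i 1)

/-- The complex structure `I₁` on `ℝ⁴`. -/
def I1 : Matrix (Fin 4) (Fin 4) ℝ :=
  !![0, -1, 0, 0; 1, 0, 0, 0; 0, 0, 0, -1; 0, 0, 1, 0]

/-- The complex structure `I₂` on `ℝ⁴`. -/
def I2 : Matrix (Fin 4) (Fin 4) ℝ :=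
  !![0, 0, -1, 0; 0, 0, 0, 1; 1, 0, 0, 0; 0, -1, 0, 0]

/-- The complex structure `I₃ = I₁ I₂` on `ℝ⁴`. -/
def I3 : Matrix (Fin 4) (Fin 4) ℝ := I1 * I2

/-- `α_J(x) = Jᵀ x`. -/
def alphaVec (J : Matrix (Fin 4) (Fin 4) ℝ) (x : Fin 4 → ℝ) : Fin 4 → ℝ :=
  Matrix.mulVec (Matrix.transpose J) x

/-- The outer product `A_{JK}(x) = α_J(x) · α_K(x)ᵀ`. -/
def Amat (J K : Matrix (Fin 4) (Fin 4) ℝ) (x : Fin 4 → ℝ) : Matrix (Fin 4) (Fin 4) ℝ :=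
  Matrix.vecMulVec (alphaVec J x) (alphaVec K x)

/-- The leading term `h⁺` of the expansion of an ALE metric,
`h⁺(x) = −(2/(3 r⁶)) · [ζ₁₁(2A₁₁−A₂₂−A₃₃) + ζ₂₂(2A₂₂−A₁₁−A₃₃) + ζ₃₃(2A₃₃−A₁₁−A₂₂)
          + ζ₁₂(A₁₂+A₂₁) + ζ₁₃(A₁₃+A₃₁) + ζ₂₃(A₂₃+A₃₂)]`. -/
def hplus (ζ11 ζ22 ζ33 ζ12 ζ13 ζ23 : ℝ) (x : Fin 4 → ℝ) : Matrix (Fin 4) (Fin 4) ℝ :=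
  (-(2 / (3 * (∑ i, x i ^ 2) ^ 3))) •
    (ζ11 • ((2 : ℝ) • Amat I1 I1 x - Amat I2 I2 x - Amat I3 I3 x) +
     ζ22 • ((2 : ℝ) • Amat I2 I2 x - Amat I1 I1 x - Amat I3 I3 x) +
     ζ33 • ((2 : ℝ) • Amat I3 I3 x - Amat I1 I1 x - Amat I2 I2 x) +
     ζ12 • (Amat I1 I2 x + Amat I2 I1 x) +
     ζ13 • (Amat I1 I3 x + Amat I3 I1 x) +
     ζ23 • (Amat I2 I3 x + Amat I3 I2 x))

/-- The reflection `ℛ = diag(1,−1,−1,−1)`. -/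
def Rrefl : Matrix (Fin 4) (Fin 4) ℝ := Matrix.diagonal ![1, -1, -1, -1]

/-- `h⁻(x) = ℛ · h⁺_ξ(ℛ x) · ℛ`. -/
def hminus (ξ11 ξ22 ξ33 ξ12 ξ13 ξ23 : ℝ) (x : Fin 4 → ℝ) : Matrix (Fin 4) (Fin 4) ℝ :=
  Rrefl * hplus ξ11 ξ22 ξ33 ξ12 ξ13 ξ23 (Matrix.mulVec Rrefl x) * Rrefl

/-- `h = h⁺ + h⁻`. -/
def hfull (ζ11 ζ22 ζ33 ζ12 ζ13 ζ23 ξ11 ξ22 ξ33 ξ12 ξ13 ξ23 : ℝ)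
    (x : Fin 4 → ℝ) : Matrix (Fin 4) (Fin 4) ℝ :=
  hplus ζ11 ζ22 ζ33 ζ12 ζ13 ζ23 x + hminus ξ11 ξ22 ξ33 ξ12 ξ13 ξ23 x

/-- The bracket in the definition of `hplus`. -/
def brk (ζ11 ζ22 ζ33 ζ12 ζ13 ζ23 : ℝ) (x : Fin 4 → ℝ) (i j : Fin 4) : ℝ :=
    (ζ11 * (2 * Amat I1 I1 x i j - Amat I2 I2 x i j - Amat I3 I3 x i j) +
     ζ22 * (2 * Amat I2 I2 x i j - Amat I1 I1 x i j - Amat I3 I3 x i j) +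
     ζ33 * (2 * Amat I3 I3 x i j - Amat I1 I1 x i j - Amat I2 I2 x i j) +
     ζ12 * (Amat I1 I2 x i j + Amat I2 I1 x i j) +
     ζ13 * (Amat I1 I3 x i j + Amat I3 I1 x i j) +
     ζ23 * (Amat I2 I3 x i j + Amat I3 I2 x i j))

/-- signs of the reflection -/
def dsg : Fin 4 → ℝ := ![1, -1, -1, -1]

/-- numerator of `hfull` -/
def Qn (ζ11 ζ22 ζ33 ζ12 ζ13 ζ23 ξ11 ξ22 ξ33 ξ12 ξ13 ξ23 : ℝ) (x : Fin 4 → ℝ) (i j : Fin 4) : ℝ :=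
  -(2 / 3) * (brk ζ11 ζ22 ζ33 ζ12 ζ13 ζ23 x i j +
    dsg i * brk ξ11 ξ22 ξ33 ξ12 ξ13 ξ23 (Matrix.mulVec Rrefl x) i j * dsg j)

lemma hplus_eq (ζ11 ζ22 ζ33 ζ12 ζ13 ζ23 : ℝ) (x : Fin 4 → ℝ) (i j : Fin 4) :
    hplus ζ11 ζ22 ζ33 ζ12 ζ13 ζ23 x i j =
      -(2 / 3) * brk ζ11 ζ22 ζ33 ζ12 ζ13 ζ23 x i j / (∑ m, x m ^ 2) ^ 3 := by
  simp only [hplus, brk, Matrix.smul_apply, Matrix.add_apply, Matrix.sub_apply, smul_eq_mul]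
  rw [div_mul_eq_div_div]
  ring

lemma Rrefl_sq (x : Fin 4 → ℝ) : ∑ m, (Matrix.mulVec Rrefl x) m ^ 2 = ∑ m, x m ^ 2 := by
  simp [Rrefl, Matrix.mulVec_diagonal, Fin.sum_univ_four]

lemma hfull_eq (ζ11 ζ22 ζ33 ζ12 ζ13 ζ23 ξ11 ξ22 ξ33 ξ12 ξ13 ξ23 : ℝ) (x : Fin 4 → ℝ)
    (i j : Fin 4) :
    hfull ζ11 ζ22 ζ33 ζ12 ζ13 ζ23 ξ11 ξ22 ξ33 ξ12 ξ13 ξ23 x i j =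
      Qn ζ11 ζ22 ζ33 ζ12 ζ13 ζ23 ξ11 ξ22 ξ33 ξ12 ξ13 ξ23 x i j / (∑ m, x m ^ 2) ^ 3 := by
  have h : hminus ξ11 ξ22 ξ33 ξ12 ξ13 ξ23 x i j =
      dsg i * hplus ξ11 ξ22 ξ33 ξ12 ξ13 ξ23 (Matrix.mulVec Rrefl x) i j * dsg j := by
    unfold hminus
    conv_lhs => rw [Rrefl, Matrix.mul_diagonal, Matrix.diagonal_mul]
    rfl
  rw [hfull, Matrix.add_apply, h, hplus_eq, hplus_eq, Rrefl_sq, Qn]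
  ring

lemma alphaVec_line (J : Matrix (Fin 4) (Fin 4) ℝ) (x v : Fin 4 → ℝ) (t : ℝ) (i : Fin 4) :
    alphaVec J (x + t • v) i = alphaVec J x i + t * alphaVec J v i := by
  simp [alphaVec, Matrix.mulVec_add, Matrix.mulVec_smul]

lemma Amat_ap (J K : Matrix (Fin 4) (Fin 4) ℝ) (x : Fin 4 → ℝ) (i j : Fin 4) :
    Amat J K x i j = alphaVec J x i * alphaVec K x j := rfl

lemma brk_line (ζ11 ζ22 ζ33 ζ12 ζ13 ζ23 : ℝ) (x v : Fin 4 → ℝ) (t : ℝ) (i j : Fin 4) :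
    brk ζ11 ζ22 ζ33 ζ12 ζ13 ζ23 (x + t • v) i j = brk ζ11 ζ22 ζ33 ζ12 ζ13 ζ23 x i j
      + t * ((brk ζ11 ζ22 ζ33 ζ12 ζ13 ζ23 (x + (1 : ℝ) • v) i j -
        brk ζ11 ζ22 ζ33 ζ12 ζ13 ζ23 (x + (-1 : ℝ) • v) i j) / 2) +
      t ^ 2 * brk ζ11 ζ22 ζ33 ζ12 ζ13 ζ23 v i j := by
  simp only [brk, Amat_ap, alphaVec_line]
  ring

lemma Qn_line (ζ11 ζ22 ζ33 ζ12 ζ13 ζ23 ξ11 ξ22 ξ33 ξ12 ξ13 ξ23 : ℝ) (x v : Fin 4 → ℝ) (t : ℝ)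
    (i j : Fin 4) :
    Qn ζ11 ζ22 ζ33 ζ12 ζ13 ζ23 ξ11 ξ22 ξ33 ξ12 ξ13 ξ23 (x + t • v) i j =
      Qn ζ11 ζ22 ζ33 ζ12 ζ13 ζ23 ξ11 ξ22 ξ33 ξ12 ξ13 ξ23 x i j
      + t * ((Qn ζ11 ζ22 ζ33 ζ12 ζ13 ζ23 ξ11 ξ22 ξ33 ξ12 ξ13 ξ23 (x + (1 : ℝ) • v) i j -
        Qn ζ11 ζ22 ζ33 ζ12 ζ13 ζ23 ξ11 ξ22 ξ33 ξ12 ξ13 ξ23 (x + (-1 : ℝ) • v) i j) / 2) +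
      t ^ 2 * Qn ζ11 ζ22 ζ33 ζ12 ζ13 ζ23 ξ11 ξ22 ξ33 ξ12 ξ13 ξ23 v i j := by
  simp only [Qn, Matrix.mulVec_add, Matrix.mulVec_smul]
  rw [brk_line _ _ _ _ _ _ x v t, brk_line _ _ _ _ _ _ _ _ t]
  ring

lemma alphaVec_diff (J : Matrix (Fin 4) (Fin 4) ℝ) (i : Fin 4) :
    Differentiable ℝ (fun x => alphaVec J x i) := by
  simp only [alphaVec, Matrix.mulVec, dotProduct]
  fun_prop

lemma alphaVec_diff_R (J : Matrix (Fin 4) (Fin 4) ℝ) (i : Fin 4) :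
    Differentiable ℝ (fun x => alphaVec J (Matrix.mulVec Rrefl x) i) := by
  simp only [alphaVec, Matrix.mulVec, dotProduct]
  fun_prop

lemma Qn_diff (ζ11 ζ22 ζ33 ζ12 ζ13 ζ23 ξ11 ξ22 ξ33 ξ12 ξ13 ξ23 : ℝ) (i j : Fin 4) :
    Differentiable ℝ
      (fun x => Qn ζ11 ζ22 ζ33 ζ12 ζ13 ζ23 ξ11 ξ22 ξ33 ξ12 ξ13 ξ23 x i j) := by
  have h := alphaVec_diff
  have h' := alphaVec_diff_R
  simp only [Qn, brk, Amat_ap]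
  have a1 := h I1 i
  have a2 := h I2 i
  have a3 := h I3 i
  have b1 := h I1 j
  have b2 := h I2 j
  have b3 := h I3 j
  have c1 := h' I1 i
  have c2 := h' I2 i
  have c3 := h' I3 i
  have d1 := h' I1 j
  have d2 := h' I2 j
  have d3 := h' I3 j
  fun_prop

/-- numerator of the flux `G_{ij,l}` for a numerator matrix `Q` -/
def Pn (Q : (Fin 4 → ℝ) → Fin 4 → Fin 4 → ℝ) (i j l : Fin 4) (x : Fin 4 → ℝ) : ℝ :=
  ((Q (x + (1 : ℝ) • Pi.single l 1) i j - Q (x + (-1 : ℝ) • Pi.single l 1) i j) / 2)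
    * (∑ m, x m ^ 2) / 4 - Q x i j * x l + x j * Q x i l + x i * Q x j l

lemma pd_formula (f : (Fin 4 → ℝ) → ℝ) (x : Fin 4 → ℝ) (l : Fin 4) (b c : ℝ)
    (hf : Differentiable ℝ f)
    (hline : ∀ t : ℝ, f (x + t • Pi.single l 1) = f x + t * b + t ^ 2 * c)
    (hx : 0 < ∑ m, x m ^ 2) :
    pd l (fun z => f z / (∑ m, z m ^ 2) ^ 3 * (∑ m, z m ^ 2) / 4) x =
      (b * (∑ m, x m ^ 2) / 4 - f x * x l) / (∑ m, x m ^ 2) ^ 3 := by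
  have hd : DifferentiableAt ℝ (fun z : Fin 4 → ℝ =>
      f z / (∑ m, z m ^ 2) ^ 3 * (∑ m, z m ^ 2) / 4) x := by
    have : (∑ m, x m ^ 2) ^ 3 ≠ 0 := by positivity
    fun_prop (disch := assumption)
  have h1 := hd.hasFDerivAt.hasLineDerivAt (Pi.single l 1)
  unfold HasLineDerivAt at h1
  have hs : ∀ t : ℝ, ∑ m, (x + t • (Pi.single l 1 : Fin 4 → ℝ)) m ^ 2 =
      (∑ m, x m ^ 2) + t * (2 * x l) + t ^ 2 := by
    intro t
    fin_cases l <;> simp [Fin.sum_univ_four, Pi.single_apply] <;> ring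
  simp only [hs, hline] at h1
  set S := ∑ m, x m ^ 2
  have hN : HasDerivAt (fun t : ℝ => f x + t * b + t ^ 2 * c) b 0 := by
    have := (((hasDerivAt_id (0:ℝ)).mul_const b).const_add (f x)).add
      (((hasDerivAt_id (0:ℝ)).pow 2).mul_const c)
    refine this.congr_deriv ?_ 
    simp
  have hD : HasDerivAt (fun t : ℝ => S + t * (2 * x l) + t ^ 2) (2 * x l) 0 := by
    have := (((hasDerivAt_id (0:ℝ)).mul_const (2 * x l)).const_add S).add
      ((hasDerivAt_id (0:ℝ)).pow 2)
    refine this.congr_deriv ?_ 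
    simp
  have h2 := ((hN.div (hD.pow 3) (by simp; positivity)).mul hD).div_const 4
  have h3 := h1.unique h2
  unfold pd
  rw [h3]
  simp
  field_simp
  ring

lemma G_eq (ζ11 ζ22 ζ33 ζ12 ζ13 ζ23 ξ11 ξ22 ξ33 ξ12 ξ13 ξ23 : ℝ) (i j l : Fin 4)
    (x : Fin 4 → ℝ) (hx : 0 < ∑ m, x m ^ 2) :
    pd l (fun z => hfull ζ11 ζ22 ζ33 ζ12 ζ13 ζ23 ξ11 ξ22 ξ33 ξ12 ξ13 ξ23 z i j *
              (∑ m, z m ^ 2) / 4) x +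
            x j * hfull ζ11 ζ22 ζ33 ζ12 ζ13 ζ23 ξ11 ξ22 ξ33 ξ12 ξ13 ξ23 x i l +
            x i * hfull ζ11 ζ22 ζ33 ζ12 ζ13 ζ23 ξ11 ξ22 ξ33 ξ12 ξ13 ξ23 x j l =
      Pn (Qn ζ11 ζ22 ζ33 ζ12 ζ13 ζ23 ξ11 ξ22 ξ33 ξ12 ξ13 ξ23) i j l x / (∑ m, x m ^ 2) ^ 3 := by
  simp only [hfull_eq]
  rw [pd_formula _ x l _ _ (Qn_diff _ _ _ _ _ _ _ _ _ _ _ _ i j)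
    (fun t => Qn_line _ _ _ _ _ _ _ _ _ _ _ _ x _ t i j) hx, Pn]
  ring

lemma Pn_cont (ζ11 ζ22 ζ33 ζ12 ζ13 ζ23 ξ11 ξ22 ξ33 ξ12 ξ13 ξ23 : ℝ) (i j l : Fin 4) :
    Continuous (Pn (Qn ζ11 ζ22 ζ33 ζ12 ζ13 ζ23 ξ11 ξ22 ξ33 ξ12 ξ13 ξ23) i j l) := by
  have h := fun a b =>
    (Qn_diff ζ11 ζ22 ζ33 ζ12 ζ13 ζ23 ξ11 ξ22 ξ33 ξ12 ξ13 ξ23 a b).continuous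
  unfold Pn
  have h1 := h i j
  have h2 := h i l
  have h3 := h j l
  have h4 := h1.comp (continuous_id.add
    (continuous_const (y := (1 : ℝ) • (Pi.single l 1 : Fin 4 → ℝ))))
  have h5 := h1.comp (continuous_id.add
    (continuous_const (y := (-1 : ℝ) • (Pi.single l 1 : Fin 4 → ℝ))))
  simp only [Function.comp_def, id] at h4 h5
  fun_prop

/-- weighted cube integral -/
def Jw (p : (Fin 3 → ℝ) → ℝ) : ℝ :=
  ∫ y in Set.Icc (fun _ : Fin 3 => (-1 : ℝ)) (fun _ => 1), p y / (1 + ∑ m, y m ^ 2) ^ 3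

lemma Jw_int (p : (Fin 3 → ℝ) → ℝ) (hp : Continuous p) :
    MeasureTheory.IntegrableOn (fun y => p y / (1 + ∑ m, y m ^ 2) ^ 3)
      (Set.Icc (fun _ : Fin 3 => (-1 : ℝ)) (fun _ => 1)) := by
  apply Continuous.integrableOn_Icc
  apply hp.div (by fun_prop)
  intro y
  positivity

lemma Jw_add (p q : (Fin 3 → ℝ) → ℝ) (hp : Continuous p) (hq : Continuous q) :
    Jw (fun y => p y + q y) = Jw p + Jw q := by
  unfold Jw
  rw [← MeasureTheory.integral_add (Jw_int p hp) (Jw_int q hq)]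
  simp only [add_div]

lemma Jw_equiv (e : (Fin 3 → ℝ) ≃ᵐ (Fin 3 → ℝ))
    (he : MeasureTheory.MeasurePreserving e MeasureTheory.volume MeasureTheory.volume)
    (h1 : ∀ y, ∑ m, (e y) m ^ 2 = ∑ m, y m ^ 2)
    (h2 : e ⁻¹' (Set.Icc (fun _ : Fin 3 => (-1 : ℝ)) (fun _ => 1)) =
      (Set.Icc (fun _ : Fin 3 => (-1 : ℝ)) (fun _ => 1))) (p : (Fin 3 → ℝ) → ℝ) :
    Jw (fun y => p (e y)) = Jw p := by
  unfold Jw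
  have := he.setIntegral_preimage_emb e.measurableEmbedding
    (fun y => p y / (1 + ∑ m, y m ^ 2) ^ 3) (Set.Icc (fun _ : Fin 3 => (-1 : ℝ)) (fun _ => 1))
  rw [← this, h2]
  simp only [h1]

lemma Jw_flip0 (p : (Fin 3 → ℝ) → ℝ) : Jw (fun y => p ![-y 0, y 1, y 2]) = Jw p := by
  let f : ∀ _ : Fin 3, ℝ ≃ᵐ ℝ :=
    ![MeasurableEquiv.neg ℝ, MeasurableEquiv.refl ℝ, MeasurableEquiv.refl ℝ]
  have hE : ∀ y, MeasurableEquiv.piCongrRight f y = ![-y 0, y 1, y 2] := by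
    intro y; ext m; fin_cases m <;> rfl
  have := Jw_equiv (MeasurableEquiv.piCongrRight f) ?_ ?_ ?_ p
  · simpa only [hE] using this
  · refine MeasureTheory.volume_preserving_pi (f := fun i => f i) ?_
    intro i
    fin_cases i
    · exact MeasureTheory.Measure.measurePreserving_neg _
    · exact MeasureTheory.MeasurePreserving.id _
    · exact MeasureTheory.MeasurePreserving.id _
  · intro y; simp [hE, Fin.sum_univ_three]
  · ext y
    simp only [Set.mem_preimage, hE, Set.mem_Icc, Pi.le_def, Fin.forall_fin_succ]
    simp
    constructor <;> rintro ⟨⟨a, b⟩, c, d⟩ <;> refine ⟨⟨?_, ?_⟩, ?_, ?_⟩ <;> first | assumption | linarith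

lemma Jw_cyc (p : (Fin 3 → ℝ) → ℝ) : Jw (fun y => p ![y 1, y 2, y 0]) = Jw p := by
  let e := MeasurableEquiv.piCongrLeft (fun _ : Fin 3 => ℝ) (finRotate 3).symm
  have hE : ∀ y, e y = ![y 1, y 2, y 0] := by
    intro y; ext m; fin_cases m <;> rfl
  have := Jw_equiv e ?_ ?_ ?_ p
  · simpa only [hE] using this
  · exact MeasureTheory.volume_measurePreserving_piCongrLeft _ _
  · intro y; simp [hE, Fin.sum_univ_three]; ring
  · ext y
    simp only [Set.mem_preimage, hE, Set.mem_Icc, Pi.le_def, Fin.forall_fin_succ]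
    simp
    tauto

lemma vec3_eta (y : Fin 3 → ℝ) : ![y 0, y 1, y 2] = y := by
  ext m; fin_cases m <;> rfl

lemma Jw_flip1 (p : (Fin 3 → ℝ) → ℝ) : Jw (fun y => p ![y 0, -y 1, y 2]) = Jw p := by
  have h1 := Jw_cyc (fun y => p ![y 2, -y 0, y 1])
  have h2 := Jw_flip0 (fun y => p ![y 2, y 0, y 1])
  have h3 := Jw_cyc (fun y => p ![y 2, y 0, y 1])
  simp only [Matrix.cons_val, vec3_eta] at h1 h2 h3
  rw [h1, h2, h3]

/-- symmetrization in the first two signs -/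
def Esym (p : (Fin 3 → ℝ) → ℝ) (a b c : ℝ) : ℝ :=
  (p ![a, b, c] + p ![-a, b, c]) + (p ![a, -b, c] + p ![-a, -b, c])

lemma Jw_zero (p : (Fin 3 → ℝ) → ℝ) (hp : Continuous p)
    (h : ∀ a b c, Esym p a b c + Esym p b c a + Esym p c a b = 0) : Jw p = 0 := by
  have e1 : Jw (fun y => p y + p ![-y 0, y 1, y 2]) = 2 * Jw p := by
    rw [Jw_add _ _ hp (by fun_prop), Jw_flip0]; ring
  have c1 : Continuous (fun y : Fin 3 → ℝ => p y + p ![-y 0, y 1, y 2]) := by fun_prop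
  have e2 : Jw (fun y => Esym p (y 0) (y 1) (y 2)) = 4 * Jw p := by
    have h1 := Jw_add _ _ c1 (c1.comp (g := fun y => p y + p ![-y 0, y 1, y 2])
      (f := fun y : Fin 3 → ℝ => ![y 0, -y 1, y 2]) (by fun_prop))
    have h2 := Jw_flip1 (fun y => p y + p ![-y 0, y 1, y 2])
    simp only [Function.comp_def] at h1
    rw [h2, e1] at h1
    simp only [Matrix.cons_val] at h1
    simp only [Esym, vec3_eta]
    linarith
  have c2 : Continuous (fun y : Fin 3 → ℝ => Esym p (y 0) (y 1) (y 2)) := by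
    unfold Esym; fun_prop
  have c3 : Continuous (fun y : Fin 3 → ℝ => Esym p (y 1) (y 2) (y 0)) := by
    unfold Esym; fun_prop
  have c4 : Continuous (fun y : Fin 3 → ℝ => Esym p (y 2) (y 0) (y 1)) := by
    unfold Esym; fun_prop
  have e3 := Jw_cyc (fun y => Esym p (y 0) (y 1) (y 2))
  have e4 := Jw_cyc (fun y => Esym p (y 1) (y 2) (y 0))
  simp only [Matrix.cons_val] at e3 e4
  have e5 := Jw_add (fun y => Esym p (y 0) (y 1) (y 2) + Esym p (y 1) (y 2) (y 0)) _
    (c2.add c3) c4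
  rw [Jw_add _ _ c2 c3, e4, e3, e2] at e5
  simp only [h] at e5
  have : Jw (fun _ => 0) = 0 := by simp [Jw]
  rw [this] at e5
  linarith

lemma al1 (x : Fin 4 → ℝ) : alphaVec I1 x = ![x 1, -x 0, x 3, -x 2] := by
  ext i; fin_cases i <;> simp [alphaVec, I1, Matrix.mulVec, dotProduct, Fin.sum_univ_four]

lemma al2 (x : Fin 4 → ℝ) : alphaVec I2 x = ![x 2, -x 3, -x 0, x 1] := by
  ext i; fin_cases i <;> simp [alphaVec, I2, Matrix.mulVec, dotProduct, Fin.sum_univ_four]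

lemma al3 (x : Fin 4 → ℝ) : alphaVec I3 x = ![x 3, x 2, -x 1, -x 0] := by
  ext i
  fin_cases i <;> simp [alphaVec, I3, I1, I2, Matrix.mulVec, dotProduct, Fin.sum_univ_four]

lemma Rv (x : Fin 4 → ℝ) : Matrix.mulVec Rrefl x = ![x 0, -x 1, -x 2, -x 3] := by
  ext i; fin_cases i <;> simp [Rrefl, Matrix.mulVec_diagonal]

lemma vec4_add (x : Fin 4 → ℝ) (t : ℝ) (l : Fin 4) :
    x + t • (Pi.single l 1 : Fin 4 → ℝ) = ![x 0 + t * (Pi.single l 1 : Fin 4 → ℝ) 0,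
      x 1 + t * (Pi.single l 1 : Fin 4 → ℝ) 1, x 2 + t * (Pi.single l 1 : Fin 4 → ℝ) 2,
      x 3 + t * (Pi.single l 1 : Fin 4 → ℝ) 3] := by
  ext i; fin_cases i <;> simp

lemma ins0 (t a b c : ℝ) : (Fin.insertNth (α := fun _ => ℝ) (0 : Fin 4) t ![a, b, c]) = ![t, a, b, c] := by
  ext i; fin_cases i <;> rfl
lemma ins1 (t a b c : ℝ) : (Fin.insertNth (α := fun _ => ℝ) (1 : Fin 4) t ![a, b, c]) = ![a, t, b, c] := by
  ext i; fin_cases i <;> rfl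
lemma ins2 (t a b c : ℝ) : (Fin.insertNth (α := fun _ => ℝ) (2 : Fin 4) t ![a, b, c]) = ![a, b, t, c] := by
  ext i; fin_cases i <;> rfl
lemma ins3 (t a b c : ℝ) : (Fin.insertNth (α := fun _ => ℝ) (3 : Fin 4) t ![a, b, c]) = ![a, b, c, t] := by
  ext i; fin_cases i <;> rfl

lemma ins_sq (l : Fin 4) (t : ℝ) (ht : t ^ 2 = 1) (y : Fin 3 → ℝ) :
    ∑ m, (Fin.insertNth (α := fun _ => ℝ) l t y) m ^ 2 = 1 + ∑ m, y m ^ 2 := by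
  rw [Fin.sum_univ_succAbove _ l]
  simp [ht]

/-- total numerator on the cube boundary -/
def ptot (ζ11 ζ22 ζ33 ζ12 ζ13 ζ23 ξ11 ξ22 ξ33 ξ12 ξ13 ξ23 : ℝ) (i j : Fin 4) (l : Fin 4)
    (y : Fin 3 → ℝ) : ℝ :=
  Pn (Qn ζ11 ζ22 ζ33 ζ12 ζ13 ζ23 ξ11 ξ22 ξ33 ξ12 ξ13 ξ23) i j l (l.insertNth 1 y) -
  Pn (Qn ζ11 ζ22 ζ33 ζ12 ζ13 ζ23 ξ11 ξ22 ξ33 ξ12 ξ13 ξ23) i j l (l.insertNth (-1) y)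

lemma ptot_cont (ζ11 ζ22 ζ33 ζ12 ζ13 ζ23 ξ11 ξ22 ξ33 ξ12 ξ13 ξ23 : ℝ) (i j l : Fin 4) :
    Continuous (ptot ζ11 ζ22 ζ33 ζ12 ζ13 ζ23 ξ11 ξ22 ξ33 ξ12 ξ13 ξ23 i j l) := by
  unfold ptot
  have h := Pn_cont ζ11 ζ22 ζ33 ζ12 ζ13 ζ23 ξ11 ξ22 ξ33 ξ12 ξ13 ξ23 i j l
  have c : ∀ t : ℝ, Continuous
      (fun y : Fin 3 → ℝ => (Fin.insertNth (α := fun _ => ℝ) l t y)) := by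
    intro t
    exact Continuous.finInsertNth l continuous_const continuous_id
  exact (h.comp (c 1)).sub (h.comp (c (-1)))

set_option maxHeartbeats 4000000 in
lemma ptot_01 (ζ11 ζ22 ζ33 ζ12 ζ13 ζ23 ξ11 ξ22 ξ33 ξ12 ξ13 ξ23 : ℝ) (a b c : ℝ) :
    ∑ l, ptot ζ11 ζ22 ζ33 ζ12 ζ13 ζ23 ξ11 ξ22 ξ33 ξ12 ξ13 ξ23 0 1 l ![a, b, c] =
      ((-32/3) * ζ11 + (16/3) * ζ22 + (16/3) * ζ33 + (-32/3) * ξ11 + (16/3) * ξ22 + (16/3) * ξ33) * (a * b) +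
      ((-8/3) * ζ12 + (-8/3) * ζ13 + (-8/3) * ξ12 + (-8/3) * ξ13) * (a * c) +
      ((-8/3) * ζ12 + (8/3) * ζ13 + (8/3) * ξ12 + (-8/3) * ξ13) * (b * c) := by
  simp (maxSteps := 2000000) only [Fin.sum_univ_four, ptot, ins0, ins1, ins2, ins3, Pn, Qn, brk, Amat_ap,
    vec4_add, al1, al2, al3, Rv, dsg, Matrix.cons_val, Pi.single_apply, Fin.reduceEq, if_true, if_false,
    Fin.isValue, mul_one, mul_zero, add_zero, one_mul]
  ring

set_option maxHeartbeats 4000000 in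
lemma ptot_02 (ζ11 ζ22 ζ33 ζ12 ζ13 ζ23 ξ11 ξ22 ξ33 ξ12 ξ13 ξ23 : ℝ) (a b c : ℝ) :
    ∑ l, ptot ζ11 ζ22 ζ33 ζ12 ζ13 ζ23 ξ11 ξ22 ξ33 ξ12 ξ13 ξ23 0 2 l ![a, b, c] =
      ((-8/3) * ζ13 + (8/3) * ξ13) * (b ^ 2) +
      ((8/3) * ζ13 + (-8/3) * ξ13) * (c ^ 2) +
      ((8/3) * ζ11 + (-16/3) * ζ22 + (8/3) * ζ33 + (-8/3) * ζ12 + (8/3) * ξ11 + (-16/3) * ξ22 + (8/3) * ξ33 + (-8/3) * ξ12) * (a * b) +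
      ((8/3) * ζ11 + (-16/3) * ζ22 + (8/3) * ζ33 + (-8/3) * ζ23 + (8/3) * ξ11 + (-16/3) * ξ22 + (8/3) * ξ33 + (-8/3) * ξ23) * (a * c) +
      ((8/3) * ζ12 + (-8/3) * ζ23 + (-8/3) * ξ12 + (8/3) * ξ23) * (b * c) := by
  simp (maxSteps := 2000000) only [Fin.sum_univ_four, ptot, ins0, ins1, ins2, ins3, Pn, Qn, brk, Amat_ap,
    vec4_add, al1, al2, al3, Rv, dsg, Matrix.cons_val, Pi.single_apply, Fin.reduceEq, if_true, if_false,
    Fin.isValue, mul_one, mul_zero, add_zero, one_mul]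
  ring

set_option maxHeartbeats 4000000 in
lemma ptot_03 (ζ11 ζ22 ζ33 ζ12 ζ13 ζ23 ξ11 ξ22 ξ33 ξ12 ξ13 ξ23 : ℝ) (a b c : ℝ) :
    ∑ l, ptot ζ11 ζ22 ζ33 ζ12 ζ13 ζ23 ξ11 ξ22 ξ33 ξ12 ξ13 ξ23 0 3 l ![a, b, c] =
      ((-8/3) * ζ13 + (-8/3) * ζ23 + (-8/3) * ξ13 + (-8/3) * ξ23) * (a * b) +
      ((16/3) * ζ11 + (16/3) * ζ22 + (-32/3) * ζ33 + (16/3) * ξ11 + (16/3) * ξ22 + (-32/3) * ξ33) * (a * c) +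
      ((-8/3) * ζ13 + (8/3) * ζ23 + (8/3) * ξ13 + (-8/3) * ξ23) * (b * c) := by
  simp (maxSteps := 2000000) only [Fin.sum_univ_four, ptot, ins0, ins1, ins2, ins3, Pn, Qn, brk, Amat_ap,
    vec4_add, al1, al2, al3, Rv, dsg, Matrix.cons_val, Pi.single_apply, Fin.reduceEq, if_true, if_false,
    Fin.isValue, mul_one, mul_zero, add_zero, one_mul]
  ring

set_option maxHeartbeats 4000000 in
lemma ptot_12 (ζ11 ζ22 ζ33 ζ12 ζ13 ζ23 ξ11 ξ22 ξ33 ξ12 ξ13 ξ23 : ℝ) (a b c : ℝ) :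
    ∑ l, ptot ζ11 ζ22 ζ33 ζ12 ζ13 ζ23 ξ11 ξ22 ξ33 ξ12 ξ13 ξ23 1 2 l ![a, b, c] =
      ((8/3) * ζ12 + (8/3) * ξ12) * (a ^ 2) +
      ((-8/3) * ζ12 + (-8/3) * ξ12) * (c ^ 2) +
      ((8/3) * ζ11 + (8/3) * ζ22 + (-16/3) * ζ33 + (8/3) * ζ13 + (8/3) * ξ11 + (8/3) * ξ22 + (-16/3) * ξ33 + (-8/3) * ξ13) * (a * b) +
      ((16/3) * ξ23) * (a * c) +
      ((8/3) * ζ11 + (8/3) * ζ22 + (-16/3) * ζ33 + (8/3) * ζ13 + (8/3) * ξ11 + (8/3) * ξ22 + (-16/3) * ξ33 + (8/3) * ξ13) * (b * c) := by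
  simp (maxSteps := 2000000) only [Fin.sum_univ_four, ptot, ins0, ins1, ins2, ins3, Pn, Qn, brk, Amat_ap,
    vec4_add, al1, al2, al3, Rv, dsg, Matrix.cons_val, Pi.single_apply, Fin.reduceEq, if_true, if_false,
    Fin.isValue, mul_one, mul_zero, add_zero, one_mul]
  ring

set_option maxHeartbeats 4000000 in
lemma ptot_13 (ζ11 ζ22 ζ33 ζ12 ζ13 ζ23 ξ11 ξ22 ξ33 ξ12 ξ13 ξ23 : ℝ) (a b c : ℝ) :
    ∑ l, ptot ζ11 ζ22 ζ33 ζ12 ζ13 ζ23 ξ11 ξ22 ξ33 ξ12 ξ13 ξ23 1 3 l ![a, b, c] =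
      ((8/3) * ζ13 + (8/3) * ξ13) * (a ^ 2) +
      ((-8/3) * ζ13 + (-8/3) * ξ13) * (b ^ 2) +
      ((-8/3) * ζ12 + (8/3) * ζ23 + (8/3) * ξ12 + (8/3) * ξ23) * (a * b) +
      ((8/3) * ζ11 + (-16/3) * ζ22 + (8/3) * ζ33 + (8/3) * ζ23 + (8/3) * ξ11 + (-16/3) * ξ22 + (8/3) * ξ33 + (-8/3) * ξ23) * (a * c) +
      ((8/3) * ζ11 + (-16/3) * ζ22 + (8/3) * ζ33 + (8/3) * ζ12 + (8/3) * ξ11 + (-16/3) * ξ22 + (8/3) * ξ33 + (8/3) * ξ12) * (b * c) := by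
  simp (maxSteps := 2000000) only [Fin.sum_univ_four, ptot, ins0, ins1, ins2, ins3, Pn, Qn, brk, Amat_ap,
    vec4_add, al1, al2, al3, Rv, dsg, Matrix.cons_val, Pi.single_apply, Fin.reduceEq, if_true, if_false,
    Fin.isValue, mul_one, mul_zero, add_zero, one_mul]
  ring

set_option maxHeartbeats 4000000 in
lemma ptot_23 (ζ11 ζ22 ζ33 ζ12 ζ13 ζ23 ξ11 ξ22 ξ33 ξ12 ξ13 ξ23 : ℝ) (a b c : ℝ) :
    ∑ l, ptot ζ11 ζ22 ζ33 ζ12 ζ13 ζ23 ξ11 ξ22 ξ33 ξ12 ξ13 ξ23 2 3 l ![a, b, c] =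
      ((8/3) * ζ12 + (8/3) * ζ13 + (-8/3) * ξ12 + (8/3) * ξ13) * (a * b) +
      ((8/3) * ζ12 + (-8/3) * ζ13 + (8/3) * ξ12 + (8/3) * ξ13) * (a * c) +
      ((-32/3) * ζ11 + (16/3) * ζ22 + (16/3) * ζ33 + (-32/3) * ξ11 + (16/3) * ξ22 + (16/3) * ξ33) * (b * c) := by
  simp (maxSteps := 2000000) only [Fin.sum_univ_four, ptot, ins0, ins1, ins2, ins3, Pn, Qn, brk, Amat_ap,
    vec4_add, al1, al2, al3, Rv, dsg, Matrix.cons_val, Pi.single_apply, Fin.reduceEq, if_true, if_false,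
    Fin.isValue, mul_one, mul_zero, add_zero, one_mul]
  ring

lemma Qn_symm (ζ11 ζ22 ζ33 ζ12 ζ13 ζ23 ξ11 ξ22 ξ33 ξ12 ξ13 ξ23 : ℝ) (x : Fin 4 → ℝ) (i j : Fin 4) :
    Qn ζ11 ζ22 ζ33 ζ12 ζ13 ζ23 ξ11 ξ22 ξ33 ξ12 ξ13 ξ23 x i j = Qn ζ11 ζ22 ζ33 ζ12 ζ13 ζ23 ξ11 ξ22 ξ33 ξ12 ξ13 ξ23 x j i := by
  simp only [Qn, brk, Amat_ap]
  ring

lemma ptot_symm (ζ11 ζ22 ζ33 ζ12 ζ13 ζ23 ξ11 ξ22 ξ33 ξ12 ξ13 ξ23 : ℝ) (i j l : Fin 4) (y : Fin 3 → ℝ) :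
    ptot ζ11 ζ22 ζ33 ζ12 ζ13 ζ23 ξ11 ξ22 ξ33 ξ12 ξ13 ξ23 i j l y = ptot ζ11 ζ22 ζ33 ζ12 ζ13 ζ23 ξ11 ξ22 ξ33 ξ12 ξ13 ξ23 j i l y := by
  simp only [ptot, Pn]
  simp only [Qn_symm _ _ _ _ _ _ _ _ _ _ _ _ _ i j]
  ring

lemma ptot_sym (ζ11 ζ22 ζ33 ζ12 ζ13 ζ23 ξ11 ξ22 ξ33 ξ12 ξ13 ξ23 : ℝ) (i j : Fin 4) (hij : i ≠ j)
    (a b c : ℝ) :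
    Esym (fun y => ∑ l, ptot ζ11 ζ22 ζ33 ζ12 ζ13 ζ23 ξ11 ξ22 ξ33 ξ12 ξ13 ξ23 i j l y) a b c +
    Esym (fun y => ∑ l, ptot ζ11 ζ22 ζ33 ζ12 ζ13 ζ23 ξ11 ξ22 ξ33 ξ12 ξ13 ξ23 i j l y) b c a +
    Esym (fun y => ∑ l, ptot ζ11 ζ22 ζ33 ζ12 ζ13 ζ23 ξ11 ξ22 ξ33 ξ12 ξ13 ξ23 i j l y) c a b
      = 0 := by
  wlog h : i < j generalizing i j with H
  · have := H j i hij.symm (lt_of_le_of_ne (not_lt.mp h) hij.symm)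
    simpa only [ptot_symm _ _ _ _ _ _ _ _ _ _ _ _ i j] using this
  fin_cases i <;> fin_cases j <;> first | exact absurd h (by decide) | skip
  all_goals
    simp only [Esym, Fin.zero_eta, Fin.mk_one, Fin.reduceFinMk, Fin.isValue,
      ptot_01, ptot_02, ptot_03, ptot_12, ptot_13, ptot_23]
    ring

open MeasureTheory

/-- For `i ≠ j`, the cube-boundary integral of
`G_{ij,l}(x) = ∂_l(h_{ij}(x)·|x|²/4) + xʲ·h_{il}(x) + xⁱ·h_{jl}(x)` vanishes. -/
theorem cube_boundary_integral_offdiag_vanishes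
    (ζ11 ζ22 ζ33 ζ12 ζ13 ζ23 ξ11 ξ22 ξ33 ξ12 ξ13 ξ23 : ℝ) (i j : Fin 4) (hij : i ≠ j) :
    ∑ l : Fin 4,
      (∫ y in Set.Icc (fun _ : Fin 3 => (-1 : ℝ)) (fun _ => 1),
        ((fun x : Fin 4 → ℝ =>
            pd l (fun z => hfull ζ11 ζ22 ζ33 ζ12 ζ13 ζ23 ξ11 ξ22 ξ33 ξ12 ξ13 ξ23 z i j *
              (∑ m, z m ^ 2) / 4) x +
            x j * hfull ζ11 ζ22 ζ33 ζ12 ζ13 ζ23 ξ11 ξ22 ξ33 ξ12 ξ13 ξ23 x i l +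
            x i * hfull ζ11 ζ22 ζ33 ζ12 ζ13 ζ23 ξ11 ξ22 ξ33 ξ12 ξ13 ξ23 x j l)
          (l.insertNth 1 y) -
         (fun x : Fin 4 → ℝ =>
            pd l (fun z => hfull ζ11 ζ22 ζ33 ζ12 ζ13 ζ23 ξ11 ξ22 ξ33 ξ12 ξ13 ξ23 z i j *
              (∑ m, z m ^ 2) / 4) x +
            x j * hfull ζ11 ζ22 ζ33 ζ12 ζ13 ζ23 ξ11 ξ22 ξ33 ξ12 ξ13 ξ23 x i l +
            x i * hfull ζ11 ζ22 ζ33 ζ12 ζ13 ζ23 ξ11 ξ22 ξ33 ξ12 ξ13 ξ23 x j l)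
          (l.insertNth (-1) y)))
      = 0 := by
  have key : ∀ l : Fin 4, ∀ y : Fin 3 → ℝ, ∀ t : ℝ, t ^ 2 = 1 →
      (fun x : Fin 4 → ℝ =>
            pd l (fun z => hfull ζ11 ζ22 ζ33 ζ12 ζ13 ζ23 ξ11 ξ22 ξ33 ξ12 ξ13 ξ23 z i j *
              (∑ m, z m ^ 2) / 4) x +
            x j * hfull ζ11 ζ22 ζ33 ζ12 ζ13 ζ23 ξ11 ξ22 ξ33 ξ12 ξ13 ξ23 x i l +
            x i * hfull ζ11 ζ22 ζ33 ζ12 ζ13 ζ23 ξ11 ξ22 ξ33 ξ12 ξ13 ξ23 x j l)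
          (l.insertNth t y) =
        Pn (Qn ζ11 ζ22 ζ33 ζ12 ζ13 ζ23 ξ11 ξ22 ξ33 ξ12 ξ13 ξ23) i j l (l.insertNth t y) /
          (1 + ∑ m, y m ^ 2) ^ 3 := by
    intro l y t ht
    have hs := ins_sq l t ht y
    have := G_eq ζ11 ζ22 ζ33 ζ12 ζ13 ζ23 ξ11 ξ22 ξ33 ξ12 ξ13 ξ23 i j l (l.insertNth t y)
      (by rw [hs]; positivity)
    rw [hs] at this
    exact this
  have hcont := ptot_cont ζ11 ζ22 ζ33 ζ12 ζ13 ζ23 ξ11 ξ22 ξ33 ξ12 ξ13 ξ23 i j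
  have hJ := Jw_zero _ (continuous_finsetSum Finset.univ fun l _ => hcont l)
    (ptot_sym ζ11 ζ22 ζ33 ζ12 ζ13 ζ23 ξ11 ξ22 ξ33 ξ12 ξ13 ξ23 i j hij)
  unfold Jw at hJ
  simp only [Finset.sum_div] at hJ
  rw [integral_finsetSum _ fun l _ => Jw_int _ (hcont l)] at hJ
  rw [← hJ]
  refine Finset.sum_congr rfl fun l _ => ?_
  refine integral_congr_ae (Filter.Eventually.of_forall fun y => ?_)
  have h1 := key l y 1 (by norm_num)
  have h2 := key l y (-1) (by norm_num)
  refine (congrArg₂ (· - ·) h1 h2).trans ?_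
  simp only [ptot, sub_div]
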